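/- arXiv:2307.02944 — 2 statements merged into one kernel-verified Lean document; each statement's English description precedes it below -/
import Mathlib

section
/- Let A be a bounded residuated lattice and a ∈ A. The following are equivalent: (i) a ∈ Rad(A); (ii) for all n > 0, the implicative filter generated by ¬(aⁿ) equals A; (iii) for every n > 0 there is k > 0 such that k.(aⁿ) = ⊤. In particular, Rad(A) = {a ∈ A : ∀ n > 0, ∃ k > 0, k.(aⁿ) = ⊤}. -/
universe u

/-- A bounded (integral, commutative) residuated lattice: a bounded lattice
with a commutative monoid operation `mul` (with unit `⊤`) and a residuum
`himp` satisfying the residuation condition. -/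
class BRL (α : Type u) extends Lattice α, BoundedOrder α where
  mul : α → α → α
  himp : α → α → α
  mul_comm : ∀ a b : α, mul a b = mul b a
  mul_assoc : ∀ a b c : α, mul (mul a b) c = mul a (mul b c)
  mul_top : ∀ a : α, mul a ⊤ = a
  residuation : ∀ a b c : α, mul a b ≤ c ↔ a ≤ himp b c

namespace BRL

variable {α : Type u} [BRL α]

/-- `¬a := a → ⊥`. -/
def neg (a : α) : α := himp a ⊥

/-- `a + b := ¬(¬a · ¬b)`. -/
def add (a b : α) : α := neg (mul (neg a) (neg b))

/-- Powers: `a⁰ = ⊤`, `aⁿ⁺¹ = a · aⁿ`. -/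
def pow (a : α) : ℕ → α
  | 0 => ⊤
  | n + 1 => mul a (pow a n)

/-- Multiples: `0.a = ⊥`, `(n+1).a = a + n.a`. -/
def nmul : ℕ → α → α
  | 0, _ => ⊥
  | n + 1, a => add a (nmul n a)

/-- Implicative filter. -/
def IsFilter (F : Set α) : Prop :=
  ⊤ ∈ F ∧ (∀ a b : α, a ∈ F → a ≤ b → b ∈ F) ∧
    (∀ a b : α, a ∈ F → b ∈ F → mul a b ∈ F)

/-- The smallest implicative filter containing `S`. -/
def genFilter (S : Set α) : Set α := ⋂₀ {F : Set α | IsFilter F ∧ S ⊆ F}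

/-- Maximal (proper) implicative filter. -/
def IsMaximal (M : Set α) : Prop :=
  IsFilter M ∧ M ≠ Set.univ ∧ ∀ G : Set α, IsFilter G → M ⊂ G → G = Set.univ

/-- Prime (proper) implicative filter. -/
def IsPrime (P : Set α) : Prop :=
  IsFilter P ∧ P ≠ Set.univ ∧ ∀ a b : α, a ⊔ b ∈ P → a ∈ P ∨ b ∈ P

/-- Minimal prime implicative filter (minimal among prime implicative filters). -/
def IsMinimalPrime (P : Set α) : Prop :=
  IsPrime P ∧ ∀ Q : Set α, IsPrime Q → Q ⊆ P → Q = P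

/-- The radical: intersection of all maximal implicative filters. -/
def Rad : Set α := {a : α | ∀ M : Set α, IsMaximal M → a ∈ M}

/-- Boolean (complemented) element. -/
def Boolean (b : α) : Prop := b ⊔ neg b = ⊤

/-- Stone ultrafilter: an implicative filter generated by an ultrafilter of
the Boolean algebra of Boolean elements. -/
def IsStoneUltra (F : Set α) : Prop :=
  IsFilter F ∧ F = genFilter (F ∩ {b : α | Boolean b}) ∧ (⊥ : α) ∉ F ∧
    ∀ b : α, Boolean b → b ∈ F ∨ neg b ∈ F

theorem mul_le_mul_right' {a b : α} (h : a ≤ b) (c : α) : mul a c ≤ mul b c :=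
  (residuation _ _ _).2 (h.trans ((residuation _ _ _).1 le_rfl))

theorem mul_le_mul_left' {a b : α} (h : a ≤ b) (c : α) : mul c a ≤ mul c b := by
  rw [mul_comm c a, mul_comm c b]
  exact mul_le_mul_right' h c

theorem top_mul (a : α) : mul ⊤ a = a := by rw [mul_comm, mul_top]

theorem mul_bot (a : α) : mul a ⊥ = ⊥ := by
  rw [mul_comm]
  exact le_bot_iff.1 ((residuation _ _ _).2 bot_le)

theorem mul_mul_mul_comm' (a b c d : α) :
    mul (mul a b) (mul c d) = mul (mul a c) (mul b d) := by
  rw [mul_assoc, mul_assoc, ← mul_assoc b, mul_comm b c, mul_assoc c]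

theorem pow_one' (a : α) : pow a 1 = a := mul_top a

theorem pow_add' (a : α) (m n : ℕ) : pow a (m + n) = mul (pow a m) (pow a n) := by
  induction m with
  | zero => rw [Nat.zero_add, pow, top_mul]
  | succ k ih => rw [Nat.succ_add, pow, pow, ih, mul_assoc]

theorem le_neg_iff {a b : α} : a ≤ neg b ↔ mul a b = ⊥ := by
  rw [neg, ← residuation, le_bot_iff]

theorem neg_mul_self (a : α) : mul (neg a) a = ⊥ := le_neg_iff.1 le_rfl

theorem neg_eq_top_iff {a : α} : neg a = ⊤ ↔ a = ⊥ := by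
  rw [← top_le_iff, le_neg_iff, top_mul]

theorem neg_top : neg (⊤ : α) = ⊥ := by
  rw [← mul_top (neg ⊤), neg_mul_self]

theorem le_neg_comm {a b : α} : a ≤ neg b ↔ b ≤ neg a := by
  rw [le_neg_iff, le_neg_iff, mul_comm]

theorem neg_neg_neg (a : α) : neg (neg (neg a)) = neg a :=
  le_antisymm (le_neg_comm.1 ((le_neg_comm.1 le_rfl).trans (le_neg_comm.1 le_rfl)))
    (le_neg_comm.1 le_rfl)

theorem neg_mul_neg_neg (a b : α) : neg (mul a (neg (neg b))) = neg (mul a b) :=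
  eq_of_forall_le_iff fun c => by
    rw [le_neg_iff, ← mul_assoc, ← le_neg_iff, neg_neg_neg, le_neg_iff, mul_assoc, ← le_neg_iff]

theorem nmul_eq_neg_pow (k : ℕ) (a : α) : nmul k a = neg (pow (neg a) k) := by
  induction k with
  | zero => rw [nmul, pow, neg_top]
  | succ k ih => rw [nmul, add, ih, neg_mul_neg_neg, pow]

theorem IsFilter.pow_mem {F : Set α} (hF : IsFilter F) {a : α} (ha : a ∈ F) (n : ℕ) :
    pow a n ∈ F := by
  induction n with
  | zero => exact hF.1
  | succ n ih => exact hF.2.2 _ _ ha ih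

theorem IsFilter.ne_univ_iff {F : Set α} (hF : IsFilter F) : F ≠ Set.univ ↔ ⊥ ∉ F := by
  rw [not_iff_not, Set.eq_univ_iff_forall]
  exact ⟨fun h => h ⊥, fun h x => hF.2.1 _ x h bot_le⟩

theorem isFilter_genFilter (S : Set α) : IsFilter (genFilter S) :=
  ⟨fun _ hF => hF.1.1, fun a b ha hab F hF => hF.1.2.1 a b (ha F hF) hab,
    fun a b ha hb F hF => hF.1.2.2 a b (ha F hF) (hb F hF)⟩

theorem subset_genFilter (S : Set α) : S ⊆ genFilter S := fun _ hx _ hF => hF.2 hx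

theorem genFilter_subset {S F : Set α} (hF : IsFilter F) (h : S ⊆ F) : genFilter S ⊆ F :=
  Set.sInter_subset_of_mem ⟨hF, h⟩

theorem isFilter_adjoin {F : Set α} (hF : IsFilter F) (a : α) :
    IsFilter {x : α | ∃ m ∈ F, ∃ n : ℕ, mul m (pow a n) ≤ x} := by
  refine ⟨⟨⊤, hF.1, 0, le_top⟩, ?_, ?_⟩
  · rintro x y ⟨m, hm, n, h⟩ hxy
    exact ⟨m, hm, n, h.trans hxy⟩
  · rintro x y ⟨m, hm, n, h⟩ ⟨m', hm', n', h'⟩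
    refine ⟨mul m m', hF.2.2 _ _ hm hm', n + n', ?_⟩
    rw [pow_add', mul_mul_mul_comm']
    exact (mul_le_mul_right' h _).trans (mul_le_mul_left' h' _)

theorem isFilter_singleton_top : IsFilter ({⊤} : Set α) := by
  refine ⟨rfl, ?_, ?_⟩
  · rintro a b rfl hab
    exact top_le_iff.1 hab
  · rintro a b rfl rfl
    exact mul_top _

theorem genFilter_singleton_eq_univ_iff (a : α) :
    genFilter {a} = Set.univ ↔ ∃ k : ℕ, 0 < k ∧ pow a k = ⊥ := by
  constructor
  · intro h
    have hsub := genFilter_subset (S := {a}) (isFilter_adjoin isFilter_singleton_top a)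
      (Set.singleton_subset_iff.2 ⟨⊤, rfl, 1, by rw [pow_one', top_mul]⟩)
    rw [h] at hsub
    obtain ⟨m, rfl, n, hn⟩ := hsub (Set.mem_univ ⊥)
    rw [top_mul, le_bot_iff] at hn
    exact ⟨n + 1, n.succ_pos, by rw [pow, hn, mul_bot]⟩
  · rintro ⟨k, -, hk⟩
    by_contra hne
    refine (isFilter_genFilter {a}).ne_univ_iff.1 hne (hk ▸ ?_)
    exact (isFilter_genFilter {a}).pow_mem (subset_genFilter {a} rfl) k

theorem IsFilter.exists_isMaximal {F : Set α} (hF : IsFilter F) (hne : F ≠ Set.univ) :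
    ∃ M : Set α, IsMaximal M ∧ F ⊆ M := by
  obtain ⟨M, hFM, hM⟩ := zorn_subset_nonempty {G : Set α | IsFilter G ∧ ⊥ ∉ G} (by
    rintro c hc hchain ⟨G₀, hG₀⟩
    refine ⟨⋃₀ c, ⟨⟨⟨G₀, hG₀, (hc hG₀).1.1⟩, ?_, ?_⟩, ?_⟩, fun s => Set.subset_sUnion_of_mem⟩
    · rintro a b ⟨G, hG, ha⟩ hab
      exact ⟨G, hG, (hc hG).1.2.1 a b ha hab⟩
    · rintro a b ⟨G, hG, ha⟩ ⟨H, hH, hb⟩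
      obtain h | h := hchain.total hG hH
      · exact ⟨H, hH, (hc hH).1.2.2 a b (h ha) hb⟩
      · exact ⟨G, hG, (hc hG).1.2.2 a b ha (h hb)⟩
    · rintro ⟨G, hG, hbot⟩
      exact (hc hG).2 hbot) F ⟨hF, hF.ne_univ_iff.1 hne⟩
  refine ⟨M, ⟨hM.prop.1, hM.prop.1.ne_univ_iff.2 hM.prop.2, fun G hG hMG => ?_⟩, hFM⟩
  by_contra hGne
  exact hMG.2 (hM.le_of_ge ⟨hG, hG.ne_univ_iff.1 hGne⟩ hMG.1)

theorem IsMaximal.exists_neg_pow_mem {M : Set α} (hM : IsMaximal M) {a : α} (ha : a ∉ M) :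
    ∃ n : ℕ, 0 < n ∧ neg (pow a n) ∈ M := by
  have huniv := hM.2.2 _ (isFilter_adjoin hM.1 a)
    ⟨fun x hx => ⟨x, hx, 0, (mul_top x).le⟩,
      fun h => ha (h ⟨⊤, hM.1.1, 1, by rw [pow_one', top_mul]⟩)⟩
  obtain ⟨m, hm, n, hn⟩ := huniv.symm ▸ Set.mem_univ (⊥ : α)
  refine ⟨n + 1, n.succ_pos, hM.1.2.1 m _ hm (le_neg_iff.2 ?_)⟩
  rw [pow, mul_comm a, ← mul_assoc, le_bot_iff.1 hn, mul_comm, mul_bot]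

theorem mem_Rad_iff_genFilter (a : α) :
    a ∈ (Rad : Set α) ↔ ∀ n : ℕ, 0 < n → genFilter {neg (pow a n)} = Set.univ := by
  constructor
  · intro ha n _
    by_contra hne
    obtain ⟨M, hM, hsub⟩ := (isFilter_genFilter _).exists_isMaximal hne
    refine hM.1.ne_univ_iff.1 hM.2.1 (neg_mul_self (pow a n) ▸ ?_)
    exact hM.1.2.2 _ _ (hsub (subset_genFilter _ rfl)) (hM.1.pow_mem (ha M hM) n)
  · intro h M hM
    by_contra ha
    obtain ⟨n, hn, hmem⟩ := hM.exists_neg_pow_mem ha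
    exact hM.2.1 (Set.univ_subset_iff.1
      (h n hn ▸ genFilter_subset hM.1 (Set.singleton_subset_iff.2 hmem)))

theorem genFilter_neg_eq_univ_iff (a : α) :
    genFilter {neg a} = Set.univ ↔ ∃ k : ℕ, 0 < k ∧ nmul k a = ⊤ := by
  simp only [genFilter_singleton_eq_univ_iff, nmul_eq_neg_pow, neg_eq_top_iff]

theorem rad_characterization (a : α) :
    (a ∈ (Rad : Set α) ↔ ∀ n : ℕ, 0 < n → genFilter {neg (pow a n)} = Set.univ) ∧
    ((∀ n : ℕ, 0 < n → genFilter {neg (pow a n)} = Set.univ) ↔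
      ∀ n : ℕ, 0 < n → ∃ k : ℕ, 0 < k ∧ nmul k (pow a n) = ⊤) ∧
    (Rad : Set α) =
      {x : α | ∀ n : ℕ, 0 < n → ∃ k : ℕ, 0 < k ∧ nmul k (pow x n) = ⊤} := by
  refine ⟨mem_Rad_iff_genFilter a, ?_, ?_⟩
  · simp only [genFilter_neg_eq_univ_iff]
  · ext x
    simp only [mem_Rad_iff_genFilter, genFilter_neg_eq_univ_iff, Set.mem_ofPred_eq]

end BRL
end

section
/- Let A be a bounded residuated lattice. Then every Stone ultrafilter of A is contained in exactly one maximal implicative filter of A (i.e., A has the General Apple Property) if and only if for every a ∈ A there exists a Boolean element b ∈ A with b ∈ ⟨a⟩ and ¬b ∈ ⟨¬a⟩. -/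
universe u

namespace BRL

variable {α : Type u} [BRL α]

theorem mul_le_mul {a b c d : α} (h : a ≤ b) (h' : c ≤ d) : mul a c ≤ mul b d := by
  have mono : ∀ x y z : α, x ≤ y → mul x z ≤ mul y z := fun x y z hxy =>
    (residuation x z _).2 (hxy.trans ((residuation y z _).1 le_rfl))
  refine (mono a b c h).trans ?_
  rw [mul_comm b c, mul_comm b d]
  exact mono c d b h'

theorem mul_le_left (a b : α) : mul a b ≤ a := by
  simpa [mul_top] using mul_le_mul (le_refl a) (le_top : b ≤ ⊤)

theorem mul_le_right (a b : α) : mul a b ≤ b := by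
  rw [mul_comm]
  exact mul_le_left b a

theorem mul_le_bot_iff {a b : α} : mul a b ≤ ⊥ ↔ a ≤ neg b := residuation a b ⊥

theorem mul_neg_le_bot (a : α) : mul a (neg a) ≤ ⊥ := by
  rw [mul_comm, mul_le_bot_iff]

theorem neg_anti {a b : α} (h : a ≤ b) : neg b ≤ neg a := by
  rw [← mul_le_bot_iff, mul_comm]
  exact (mul_le_mul h le_rfl).trans (mul_neg_le_bot b)

/-- Multiplication distributes over joins. -/
theorem sup_mul_le (a b c : α) : mul (a ⊔ b) c ≤ mul a c ⊔ mul b c :=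
  (residuation _ _ _).2 (sup_le ((residuation _ _ _).1 le_sup_left)
    ((residuation _ _ _).1 le_sup_right))

theorem Boolean.neg {b : α} (hb : Boolean b) : Boolean (neg b) := by
  refine top_le_iff.1 (hb.ge.trans (sup_le ?_ le_sup_left))
  exact (mul_le_bot_iff.1 (mul_neg_le_bot b)).trans le_sup_right

theorem Boolean.le_mul_self {b : α} (hb : Boolean b) : b ≤ mul b b := by
  have h := sup_mul_le b (BRL.neg b) b
  rw [hb, top_mul] at h
  refine h.trans (sup_le le_rfl ?_)
  rw [mul_comm]
  exact (mul_neg_le_bot b).trans bot_le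

theorem Boolean.mul {b c : α} (hb : Boolean b) (hc : Boolean c) : Boolean (mul b c) := by
  have h := sup_mul_le b (BRL.neg b) c
  rw [hb, top_mul] at h
  refine top_le_iff.1 (hc.ge.trans (sup_le (h.trans (sup_le le_sup_left ?_)) ?_))
  · exact (mul_le_left _ _).trans ((neg_anti (mul_le_left b c)).trans le_sup_right)
  · exact (neg_anti (mul_le_right b c)).trans le_sup_right

theorem boolean_top : Boolean (⊤ : α) := top_sup_eq _

theorem mem_genFilter_singleton (a : α) : a ∈ genFilter {a} := subset_genFilter _ rfl

theorem IsMaximal.bot_notMem {M : Set α} (hM : IsMaximal M) : ⊥ ∉ M :=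
  hM.1.ne_univ_iff.1 hM.2.1

theorem IsFilter.notMem_neg {F : Set α} (hF : IsFilter F) (hbot : ⊥ ∉ F) {a : α}
    (ha : a ∈ F) : neg a ∉ F :=
  fun hn => hbot (hF.2.1 _ _ (hF.2.2 _ _ ha hn) (mul_neg_le_bot a))

/-- The join of two implicative filters. -/
def filterSup (F G : Set α) : Set α := {x | ∃ f ∈ F, ∃ g ∈ G, mul f g ≤ x}

theorem isFilter_filterSup {F G : Set α} (hF : IsFilter F) (hG : IsFilter G) :
    IsFilter (filterSup F G) := by
  refine ⟨⟨⊤, hF.1, ⊤, hG.1, le_top⟩, ?_, ?_⟩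
  · rintro a b ⟨f, hf, g, hg, h⟩ hab
    exact ⟨f, hf, g, hg, h.trans hab⟩
  · rintro a b ⟨f, hf, g, hg, h⟩ ⟨f', hf', g', hg', h'⟩
    refine ⟨mul f f', hF.2.2 _ _ hf hf', mul g g', hG.2.2 _ _ hg hg', ?_⟩
    rw [mul_mul_mul_comm']
    exact mul_le_mul h h'

theorem subset_filterSup_left {F G : Set α} (hG : IsFilter G) : F ⊆ filterSup F G :=
  fun x hx => ⟨x, hx, ⊤, hG.1, mul_le_left _ _⟩

theorem subset_filterSup_right {F G : Set α} (hF : IsFilter F) : G ⊆ filterSup F G :=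
  fun x hx => ⟨⊤, hF.1, x, hx, mul_le_right _ _⟩

/-- The implicative filter generated by the Boolean elements of a filter. -/
def booleanCore (F : Set α) : Set α := {x | ∃ b ∈ F, Boolean b ∧ b ≤ x}

theorem isFilter_booleanCore {F : Set α} (hF : IsFilter F) : IsFilter (booleanCore F) := by
  refine ⟨⟨⊤, hF.1, boolean_top, le_rfl⟩, ?_, ?_⟩
  · rintro a b ⟨c, hc, hcB, h⟩ hab
    exact ⟨c, hc, hcB, h.trans hab⟩
  · rintro a b ⟨c, hc, hcB, h⟩ ⟨d, hd, hdB, h'⟩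
    exact ⟨mul c d, hF.2.2 _ _ hc hd, hcB.mul hdB, mul_le_mul h h'⟩

theorem booleanCore_subset {F : Set α} (hF : IsFilter F) : booleanCore F ⊆ F := by
  rintro x ⟨b, hb, -, h⟩
  exact hF.2.1 _ _ hb h

theorem exists_isMaximal_of_bot_notMem {F : Set α} (hF : IsFilter F) (hbot : ⊥ ∉ F) :
    ∃ M : Set α, IsMaximal M ∧ F ⊆ M := by
  obtain ⟨M, hFM, hM⟩ := zorn_subset_nonempty {G : Set α | IsFilter G ∧ ⊥ ∉ G} (by
    rintro c hc hchain ⟨G₀, hG₀⟩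
    refine ⟨⋃₀ c, ⟨⟨⟨G₀, hG₀, (hc hG₀).1.1⟩, ?_, ?_⟩, ?_⟩, fun s hs => Set.subset_sUnion_of_mem hs⟩
    · rintro a b ⟨G, hG, ha⟩ hab
      exact ⟨G, hG, (hc hG).1.2.1 _ _ ha hab⟩
    · rintro a b ⟨G, hG, ha⟩ ⟨H, hH, hb⟩
      rcases hchain.total hG hH with h | h
      · exact ⟨H, hH, (hc hH).1.2.2 _ _ (h ha) hb⟩
      · exact ⟨G, hG, (hc hG).1.2.2 _ _ ha (h hb)⟩
    · rintro ⟨G, hG, h⟩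
      exact (hc hG).2 h) F ⟨hF, hbot⟩
  refine ⟨M, ⟨hM.prop.1, hM.prop.1.ne_univ_iff.2 hM.prop.2, fun G hG hMG => ?_⟩, hFM⟩
  by_contra hne
  exact hMG.2 (hM.le_of_ge ⟨hG, hG.ne_univ_iff.1 hne⟩ hMG.1)

/-- An element outside a maximal filter generates an element whose negation lies in it. -/
theorem IsMaximal.exists_neg_mem {M : Set α} (hM : IsMaximal M) {a : α} (ha : a ∉ M) :
    ∃ c ∈ genFilter {a}, neg c ∈ M := by
  have hS := isFilter_filterSup hM.1 (isFilter_genFilter {a})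
  have huniv : filterSup M (genFilter {a}) = Set.univ :=
    hM.2.2 _ hS ⟨subset_filterSup_left (isFilter_genFilter _),
      fun h => ha (h (subset_filterSup_right hM.1 (mem_genFilter_singleton a)))⟩
  obtain ⟨m, hm, c, hc, h⟩ : ⊥ ∈ filterSup M (genFilter {a}) := huniv ▸ Set.mem_univ _
  exact ⟨c, hc, hM.1.2.1 _ _ hm (mul_le_bot_iff.1 h)⟩

theorem Boolean.le_of_mem_genFilter {b c : α} (hb : Boolean b) (hc : c ∈ genFilter {b}) :
    b ≤ c :=
  genFilter_subset (F := Set.Ici b)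
    ⟨le_top, fun _ _ hx hxy => le_trans hx hxy,
      fun _ _ hx hy => hb.le_mul_self.trans (mul_le_mul hx hy)⟩
    (Set.singleton_subset_iff.2 le_rfl) hc

theorem IsMaximal.isStoneUltra_booleanCore {M : Set α} (hM : IsMaximal M) :
    IsStoneUltra (booleanCore M) := by
  have hF := isFilter_booleanCore hM.1
  refine ⟨hF, Set.Subset.antisymm ?_ (genFilter_subset hF Set.inter_subset_left),
    fun h => hM.bot_notMem (booleanCore_subset hM.1 h), fun b hb => ?_⟩
  · rintro x ⟨b, hbM, hb, hbx⟩
    exact (isFilter_genFilter _).2.1 _ _ (subset_genFilter _ ⟨⟨b, hbM, hb, le_rfl⟩, hb⟩) hbx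
  · by_cases hbM : b ∈ M
    · exact Or.inl ⟨b, hbM, hb, le_rfl⟩
    · obtain ⟨c, hc, hcM⟩ := hM.exists_neg_mem hbM
      exact Or.inr ⟨BRL.neg b,
        hM.1.2.1 _ _ hcM (neg_anti (hb.le_of_mem_genFilter hc)), hb.neg, le_rfl⟩

/-- If a maximal filter contains all Boolean elements of `G`, then its Boolean core and `G`
lie in a common maximal filter. -/
theorem IsMaximal.exists_isMaximal_booleanCore_subset {M G : Set α} (hM : IsMaximal M)
    (hG : IsFilter G) (hGM : booleanCore G ⊆ M) :
    ∃ N : Set α, IsMaximal N ∧ booleanCore M ⊆ N ∧ G ⊆ N := by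
  have hF := isFilter_booleanCore hM.1
  obtain ⟨N, hN, hsub⟩ := exists_isMaximal_of_bot_notMem (isFilter_filterSup hF hG) (by
    rintro ⟨f, ⟨b, hbM, hb, hbf⟩, g, hg, h⟩
    have hgb : g ≤ BRL.neg b := by
      rw [← mul_le_bot_iff, mul_comm]
      exact (mul_le_mul hbf le_rfl).trans h
    exact hM.1.notMem_neg hM.bot_notMem hbM
      (hGM ⟨_, hG.2.1 _ _ hg hgb, hb.neg, le_rfl⟩))
  exact ⟨N, hN, (subset_filterSup_left hG).trans hsub, (subset_filterSup_right hF).trans hsub⟩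

theorem gap_iff_boolean_witness :
    (∀ F : Set α, IsStoneUltra F → ∃! M : Set α, IsMaximal M ∧ F ⊆ M) ↔
    (∀ a : α, ∃ b : α, Boolean b ∧ b ∈ genFilter {a} ∧ neg b ∈ genFilter {neg a}) := by
  constructor
  · intro hgap a
    by_contra! hno
    have hA := isFilter_genFilter ({a} : Set α)
    have hA' := isFilter_genFilter ({neg a} : Set α)
    have hC := isFilter_booleanCore hA
    have hC' := isFilter_booleanCore hA'
    obtain ⟨M, hM, hsub⟩ := exists_isMaximal_of_bot_notMem (isFilter_filterSup hC hC') (by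
      rintro ⟨f, ⟨b, hbA, hb, hbf⟩, g, hg, h⟩
      refine hno b hb hbA (hA'.2.1 _ _ (booleanCore_subset hA' hg) ?_)
      rw [← mul_le_bot_iff, mul_comm]
      exact (mul_le_mul hbf le_rfl).trans h)
    obtain ⟨N, hN, hMN, hAN⟩ := hM.exists_isMaximal_booleanCore_subset hA
      ((subset_filterSup_left hC').trans hsub)
    obtain ⟨N', hN', hMN', hAN'⟩ := hM.exists_isMaximal_booleanCore_subset hA'
      ((subset_filterSup_right hC).trans hsub)
    obtain rfl : N = N' :=
      (hgap _ hM.isStoneUltra_booleanCore).unique ⟨hN, hMN⟩ ⟨hN', hMN'⟩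
    exact hN.1.notMem_neg hN.bot_notMem (hAN (mem_genFilter_singleton a))
      (hAN' (mem_genFilter_singleton _))
  · rintro hwit F ⟨hF, -, hbot, hult⟩
    refine existsUnique_of_exists_of_unique (exists_isMaximal_of_bot_notMem hF hbot) ?_
    rintro N M ⟨hN, hFN⟩ ⟨hM, hFM⟩
    by_contra hne
    have hMN : ¬ M ⊆ N := fun h => hN.2.1 (hM.2.2 N hN.1 (h.ssubset_of_ne (Ne.symm hne)))
    obtain ⟨a, haM, haN⟩ := Set.not_subset.1 hMN
    obtain ⟨c, hc, hcN⟩ := hN.exists_neg_mem haN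
    have hcM : c ∈ M := genFilter_subset hM.1 (Set.singleton_subset_iff.2 haM) hc
    obtain ⟨b, hb, hbc, hbc'⟩ := hwit c
    have hbM : b ∈ M := genFilter_subset hM.1 (Set.singleton_subset_iff.2 hcM) hbc
    have hbN : neg b ∈ N := genFilter_subset hN.1 (Set.singleton_subset_iff.2 hcN) hbc'
    rcases hult b hb with h | h
    · exact hN.1.notMem_neg hN.bot_notMem (hFN h) hbN
    · exact hM.1.notMem_neg hM.bot_notMem hbM (hFM h)

end BRL
end
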